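/- Let n ≥ 3, let a ∈ ℝ and A > 0, and let u be a positive continuously differentiable function on E = {x ∈ ℝⁿ₊ : |x| ≥ 1} satisfying |u(x) − 1 − a|x|^{2−n}| ≤ A|x|^{1−n} and |∇u(x) − (2−n)a|x|^{−n}x| ≤ A|x|^{−n} for all x ∈ E. Define the conformally flat metric coefficients g_{ij} = u^{4/(n−2)} δ_{ij} on E. Then the mass integrals converge and lim_{r → ∞} ∫_{S⁺_r} Σ_{i,j=1}^{n} ( ∂_j g_{ij}(x) − ∂_i g_{jj}(x) ) (x_i/r) dH^{n−1}(x) = 2(n−1) ω_{n−1} a. -/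

import Mathlib

open MeasureTheory Metric Filter
open scoped ENNReal Topology

noncomputable section

/-- The closed half-space `{x : x k ≥ 0}`, where `k` is the distinguished (last) coordinate. -/
def upperHalf (n : ℕ) (k : Fin n) : Set (EuclideanSpace ℝ (Fin n)) := {x | 0 ≤ x k}

/-- The exterior region `E = {x ∈ ℝⁿ₊ : |x| ≥ 1}`. -/
def extRegionCl (n : ℕ) (k : Fin n) : Set (EuclideanSpace ℝ (Fin n)) :=
  {x | 0 ≤ x k ∧ 1 ≤ ‖x‖}

/-- The conformally flat metric coefficients `g_{ij} = u^{4/(n-2)} δ_{ij}`. -/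
def confMet (n : ℕ) (u : EuclideanSpace ℝ (Fin n) → ℝ) (i j : Fin n)
    (x : EuclideanSpace ℝ (Fin n)) : ℝ :=
  if i = j then u x ^ ((4 : ℝ) / ((n : ℝ) - 2)) else 0

/-- The area `ω_{n-1}` of the unit sphere `S^{n-1} ⊂ ℝⁿ`. -/
def sphereArea (n : ℕ) : ℝ :=
  (μH[(n : ℝ) - 1] (sphere (0 : EuclideanSpace ℝ (Fin n)) 1)).toReal

/-- The mass integrand `Σ_{i,j} (∂_j g_{ij} - ∂_i g_{jj}) xᵢ/r` for the metric
`g_{ij} = u^{4/(n-2)} δ_{ij}`, with derivatives taken within the region `S`. -/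
def massIntegrand (n : ℕ) (S : Set (EuclideanSpace ℝ (Fin n)))
    (u : EuclideanSpace ℝ (Fin n) → ℝ) (r : ℝ) (x : EuclideanSpace ℝ (Fin n)) : ℝ :=
  ∑ i : Fin n, ∑ j : Fin n,
    (fderivWithin ℝ (confMet n u i j) S x (EuclideanSpace.single j 1) -
      fderivWithin ℝ (confMet n u j j) S x (EuclideanSpace.single i 1)) * (x i / r)

/-- The part of the unit sphere in a half-space is the image of a disc under the inverse
stereographic projection, hence has finite Hausdorff measure in codimension one. -/
theorem hausdorffMeasure_hemisphere_lt_top {E : Type*} [NormedAddCommGroup E]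
    [InnerProductSpace ℝ E] [FiniteDimensional ℝ E] [MeasurableSpace E] [BorelSpace E]
    {m : ℕ} (hm : Module.finrank ℝ E = m + 1) {v : E} (hv : ‖v‖ = 1) :
    μH[(m : ℝ)] ({x : E | inner ℝ v x ≤ 0} ∩ sphere 0 1) < ⊤ := by
  have : Fact (Module.finrank ℝ E = m + 1) := ⟨hm⟩
  have hv0 : v ≠ 0 := by rintro rfl; simp at hv
  have hrank : Module.finrank ℝ (ℝ ∙ v)ᗮ = m := Submodule.finrank_orthogonal_span_singleton hv0
  have hcd : ContDiff ℝ 1 (fun w : (ℝ ∙ v)ᗮ => stereoInvFunAux v (w : E)) :=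
    contDiff_stereoInvFunAux.comp (ℝ ∙ v)ᗮ.subtypeL.contDiff
  obtain ⟨K, hK⟩ := hcd.contDiffOn.exists_lipschitzOnWith (s := closedBall 0 2) one_ne_zero
    (convex_closedBall _ _) (isCompact_closedBall _ _)
  have hball : μH[(m : ℝ)] (closedBall (0 : (ℝ ∙ v)ᗮ) 2) < ⊤ := by
    rw [← hrank]
    exact (isCompact_closedBall _ _).measure_lt_top
  refine lt_of_le_of_lt (measure_mono ?_) ((hK.hausdorffMeasure_image_le
    (Nat.cast_nonneg m)).trans_lt (ENNReal.mul_lt_top (by simp) hball))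
  rintro x ⟨hx, hx1⟩
  have hxv : x ≠ v := by
    rintro rfl
    simp [hv] at hx
    linarith
  refine ⟨stereoToFun v x, ?_, congrArg Subtype.val (stereo_left_inv hv (x := ⟨x, hx1⟩) hxv)⟩
  rw [mem_closedBall_zero_iff, stereoToFun_apply, norm_smul, innerSL_apply_apply]
  have hx' : inner ℝ v x ≤ 0 := hx
  have h1 : ‖(2 : ℝ) / (1 - inner ℝ v x)‖ ≤ 2 := by
    rw [Real.norm_of_nonneg (by apply div_nonneg <;> linarith), div_le_iff₀ (by linarith)]
    linarith
  have h2 : ‖(ℝ ∙ v)ᗮ.orthogonalProjectionOnto x‖ ≤ 1 :=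
    ((ℝ ∙ v)ᗮ.norm_orthogonalProjectionOnto_apply_le x).trans
      (mem_sphere_zero_iff_norm.1 hx1).le
  nlinarith [norm_nonneg ((ℝ ∙ v)ᗮ.orthogonalProjectionOnto x)]

/-- The equator of the unit sphere is null for the codimension one Hausdorff measure. -/
theorem hausdorffMeasure_equator {E : Type*} [NormedAddCommGroup E]
    [InnerProductSpace ℝ E] [FiniteDimensional ℝ E] [MeasurableSpace E] [BorelSpace E]
    {m : ℕ} (hm : Module.finrank ℝ E = m + 1) {v : E} (hv : v ≠ 0) :
    μH[(m : ℝ)] ({x : E | inner ℝ v x = 0} ∩ sphere 0 1) = 0 := by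
  have : Fact (Module.finrank ℝ E = m + 1) := ⟨hm⟩
  have hrank : Module.finrank ℝ (ℝ ∙ v)ᗮ = m := Submodule.finrank_orthogonal_span_singleton hv
  have himg : {x : E | inner ℝ v x = 0} ∩ sphere 0 1 =
      ((↑) : (ℝ ∙ v)ᗮ → E) '' sphere 0 1 := by
    ext x
    simp [Submodule.mem_orthogonal_singleton_iff_inner_right, and_comm]
  rw [himg, isometry_subtype_coe.hausdorffMeasure_image (Or.inl (Nat.cast_nonneg m)), ← hrank]
  exact Measure.addHaar_sphere_of_ne_zero _ _ one_ne_zero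

/-- Each of the two closed hemispheres carries half of the measure of the unit sphere. -/
theorem hausdorffMeasure_sphere_eq_two_mul {E : Type*} [NormedAddCommGroup E]
    [InnerProductSpace ℝ E] [FiniteDimensional ℝ E] [MeasurableSpace E] [BorelSpace E]
    {m : ℕ} (hm : Module.finrank ℝ E = m + 1) {v : E} (hv : v ≠ 0) :
    μH[(m : ℝ)] (sphere (0 : E) 1) =
      2 * μH[(m : ℝ)] ({x : E | 0 ≤ inner ℝ v x} ∩ sphere 0 1) := by
  have hcont : Continuous fun x : E => inner ℝ v x := by fun_prop
  have hflip : μH[(m : ℝ)] ({x : E | inner ℝ v x ≤ 0} ∩ sphere 0 1) =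
      μH[(m : ℝ)] ({x : E | 0 ≤ inner ℝ v x} ∩ sphere 0 1) := by
    rw [← (IsometryEquiv.neg E).hausdorffMeasure_image]
    congr 1
    ext x
    simp
  have hnull : ({x : E | 0 < inner ℝ v x} ∩ sphere 0 1 : Set E) =ᵐ[μH[(m : ℝ)]]
      ({x : E | 0 ≤ inner ℝ v x} ∩ sphere 0 1 : Set E) := by
    refine (LE.le.eventuallyLE ?_).antisymm ?_
    · rintro x ⟨h, h'⟩
      exact ⟨(show 0 < inner ℝ v x from h).le, h'⟩
    · refine ae_le_set.2 (measure_mono_null ?_ (hausdorffMeasure_equator hm hv))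
      rintro x ⟨⟨h, h'⟩, h''⟩
      refine ⟨le_antisymm (not_lt.1 fun h3 => h'' ⟨h3, h'⟩) h, h'⟩
  have hsplit := measure_inter_add_sdiff (μ := μH[(m : ℝ)]) (sphere (0 : E) 1)
    (t := {x : E | inner ℝ v x ≤ 0}) (measurableSet_le hcont.measurable measurable_const)
  have hdiff : sphere (0 : E) 1 \ {x : E | inner ℝ v x ≤ 0} =
      {x : E | 0 < inner ℝ v x} ∩ sphere 0 1 := by
    ext x
    simp [and_comm]
  rw [← hsplit, Set.inter_comm, hdiff, measure_congr hnull, hflip, two_mul]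

theorem uniqueDiffOn_extRegionCl (n : ℕ) (k : Fin n) : UniqueDiffOn ℝ (extRegionCl n k) := by
  rintro x ⟨hxk, hx1⟩
  have hsq : 0 < ‖x‖ ^ 2 := by positivity
  have hk : Continuous fun y : EuclideanSpace ℝ (Fin n) => y k := by fun_prop
  have hin : Continuous fun y : EuclideanSpace ℝ (Fin n) => inner ℝ x y := by fun_prop
  set C : Set (EuclideanSpace ℝ (Fin n)) := {y | 0 ≤ y k} ∩ {y | ‖x‖ ^ 2 ≤ inner ℝ x y} with hC
  have hsub : C ⊆ extRegionCl n k := by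
    rintro y ⟨hyk, hy⟩
    refine ⟨hyk, ?_⟩
    have hy' : ‖x‖ ^ 2 ≤ inner ℝ x y := hy
    nlinarith [real_inner_le_norm x y]
  refine UniqueDiffWithinAt.mono (uniqueDiffWithinAt_convex ?_ ?_ (subset_closure ?_)) hsub
  · exact (convex_halfSpace_ge (f := fun y : EuclideanSpace ℝ (Fin n) => y k)
      ⟨by simp, by simp⟩ 0).inter
      (convex_halfSpace_ge (f := fun y => inner ℝ x y)
        ⟨fun y z => inner_add_right x y z, fun c y => inner_smul_right x y c⟩ _)
  · refine ⟨(2 : ℝ) • x + EuclideanSpace.single k 1, interior_maximal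
      (t := {y | 0 < y k} ∩ {y | ‖x‖ ^ 2 < inner ℝ x y}) ?_ ?_ ⟨?_, ?_⟩⟩
    · rintro y ⟨h1, h2⟩
      exact ⟨(show 0 < y k from h1).le, (show ‖x‖ ^ 2 < inner ℝ x y from h2).le⟩
    · exact (isOpen_lt continuous_const hk).inter (isOpen_lt continuous_const hin)
    · simp
      linarith
    · simp only [Set.mem_ofPred_eq, inner_add_right, inner_smul_right,
        real_inner_self_eq_norm_sq, EuclideanSpace.inner_single_right]
      simp
      linarith
  · exact ⟨hxk, (real_inner_self_eq_norm_sq x).ge⟩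

theorem massIntegrand_eq {n : ℕ} {S : Set (EuclideanSpace ℝ (Fin n))}
    {u : EuclideanSpace ℝ (Fin n) → ℝ} {x : EuclideanSpace ℝ (Fin n)}
    (hS : UniqueDiffWithinAt ℝ S x) (hu : DifferentiableWithinAt ℝ u S x) (hx : 0 < u x) (r : ℝ) :
    massIntegrand n S u r x = (1 - (n : ℝ)) * ((4 : ℝ) / ((n : ℝ) - 2)) *
      u x ^ ((4 : ℝ) / ((n : ℝ) - 2) - 1) * (fderivWithin ℝ u S x x / r) := by
  set p := (4 : ℝ) / ((n : ℝ) - 2) with hp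
  set L := fderivWithin ℝ u S x with hL
  have hD : ∀ i j : Fin n, fderivWithin ℝ (confMet n u i j) S x =
      if i = j then (p * u x ^ (p - 1)) • L else 0 := by
    intro i j
    split_ifs with h
    · have : confMet n u i j = fun y => u y ^ p := by
        ext y
        simp [confMet, h, hp]
      rw [this]
      exact (hu.hasFDerivWithinAt.rpow_const (Or.inl hx.ne')).fderivWithin hS
    · have : confMet n u i j = fun _ => 0 := by
        ext y
        simp [confMet, h]
      rw [this, fderivWithin_fun_const]
      rfl
  have hLx : L x = ∑ i, x i * L (EuclideanSpace.single i 1) := by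
    conv_lhs => rw [← (EuclideanSpace.basisFun (Fin n) ℝ).sum_repr x]
    simp
  have hinner : ∀ i : Fin n, ∑ j : Fin n,
      (fderivWithin ℝ (confMet n u i j) S x (EuclideanSpace.single j 1) -
        fderivWithin ℝ (confMet n u j j) S x (EuclideanSpace.single i 1)) * (x i / r) =
      (1 - (n : ℝ)) * p * u x ^ (p - 1) / r * (x i * L (EuclideanSpace.single i 1)) := by
    intro i
    rw [← Finset.sum_mul, Finset.sum_sub_distrib]
    have h1 : ∑ j : Fin n, fderivWithin ℝ (confMet n u i j) S x (EuclideanSpace.single j 1) =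
        p * u x ^ (p - 1) * L (EuclideanSpace.single i 1) := by
      rw [Finset.sum_eq_single i]
      · simp [hD]
      · intro j _ hj
        simp [hD, hj.symm]
      · simp
    rw [h1]
    simp only [hD, if_true, Finset.sum_const, Finset.card_univ, Fintype.card_fin,
      nsmul_eq_mul, smul_eq_mul, smul_apply]
    ring
  rw [massIntegrand, Finset.sum_congr rfl fun i _ => hinner i, ← Finset.mul_sum, ← hLx]
  ring

theorem continuousOn_massIntegrand {n : ℕ} {S : Set (EuclideanSpace ℝ (Fin n))}
    {u : EuclideanSpace ℝ (Fin n) → ℝ} (hS : UniqueDiffOn ℝ S) (hu : ContDiffOn ℝ 1 u S)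
    (hpos : ∀ x ∈ S, 0 < u x) (r : ℝ) : ContinuousOn (massIntegrand n S u r) S := by
  have hL : ContinuousOn (fun x => fderivWithin ℝ u S x x) S :=
    (hu.continuousOn_fderivWithin hS le_rfl).clm_apply continuousOn_id
  refine ContinuousOn.congr ?_ fun x hx =>
    massIntegrand_eq (hS x hx) (hu.differentiableOn one_ne_zero x hx) (hpos x hx) r
  exact (continuousOn_const.mul (hu.continuousOn.rpow_const fun x hx => Or.inl (hpos x hx).ne')).mul
    (hL.div_const r)

open scoped Pointwise in
theorem hausdorffMeasure_upperHalf_inter_sphere {n : ℕ} (hn : 1 ≤ n) (k : Fin n) {r : ℝ}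
    (hr : 0 < r) :
    μH[(n : ℝ) - 1] (upperHalf n k ∩ sphere 0 r) =
      ENNReal.ofReal (r ^ ((n : ℝ) - 1)) * μH[(n : ℝ) - 1] (upperHalf n k ∩ sphere 0 1) := by
  have hd : (0 : ℝ) ≤ (n : ℝ) - 1 := by
    have : (1 : ℝ) ≤ n := by exact_mod_cast hn
    linarith
  have hset : upperHalf n k ∩ sphere 0 r = r • (upperHalf n k ∩ sphere 0 1) := by
    ext x
    rw [Set.mem_smul_set_iff_inv_smul_mem₀ hr.ne']
    simp only [upperHalf, Set.mem_inter_iff, Set.mem_ofPred_eq, mem_sphere_zero_iff_norm,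
      PiLp.smul_apply, smul_eq_mul, norm_smul, norm_inv, Real.norm_of_nonneg hr.le]
    rw [mul_nonneg_iff_of_pos_left (inv_pos.2 hr), inv_mul_eq_one₀ hr.ne', eq_comm (a := r)]
  rw [hset, Measure.hausdorffMeasure_smul₀ hd hr.ne', ENNReal.smul_def, smul_eq_mul]
  congr 1
  rw [← ENNReal.ofReal_coe_nnreal, NNReal.coe_rpow, coe_nnnorm, Real.norm_of_nonneg hr.le]

theorem upperHalf_inter_sphere_one {n : ℕ} (k : Fin n) :
    upperHalf n k ∩ sphere 0 1 =
      {x | 0 ≤ inner ℝ (EuclideanSpace.single k (1 : ℝ)) x} ∩ sphere 0 1 := by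
  ext x
  simp [upperHalf, EuclideanSpace.inner_single_left]

theorem hausdorffMeasure_upperHalf_inter_sphere_one_lt_top {n : ℕ} (hn : 1 ≤ n) (k : Fin n) :
    μH[(n : ℝ) - 1] (upperHalf n k ∩ sphere 0 1) < ⊤ := by
  obtain ⟨m, rfl⟩ := Nat.exists_eq_add_of_le' hn
  have := hausdorffMeasure_hemisphere_lt_top (E := EuclideanSpace ℝ (Fin (m + 1))) (m := m)
    (by simp) (v := -EuclideanSpace.single k (1 : ℝ)) (by simp)
  rw [upperHalf_inter_sphere_one]
  simpa using this

theorem sphereArea_eq {n : ℕ} (hn : 1 ≤ n) (k : Fin n) :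
    sphereArea n = 2 * (μH[(n : ℝ) - 1]).real (upperHalf n k ∩ sphere 0 1) := by
  obtain ⟨m, rfl⟩ := Nat.exists_eq_add_of_le' hn
  have := hausdorffMeasure_sphere_eq_two_mul (E := EuclideanSpace ℝ (Fin (m + 1))) (m := m)
    (by simp) (v := EuclideanSpace.single k (1 : ℝ)) (by simp)
  rw [sphereArea, upperHalf_inter_sphere_one, measureReal_def]
  simp only [Nat.cast_add, Nat.cast_one, add_sub_cancel_right]
  rw [this, ENNReal.toReal_mul, ENNReal.toReal_ofNat]

/-- If a function on the hemispheres of radius `r` is asymptotic to `c * r ^ (1 - n)`, then its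
integral tends to `c` times the area of the unit hemisphere. -/
theorem tendsto_setIntegral_upperHalf_inter_sphere {n : ℕ} (hn : 1 ≤ n) (k : Fin n)
    {F : ℝ → EuclideanSpace ℝ (Fin n) → ℝ} {c : ℝ}
    (hint : ∀ᶠ r in atTop, IntegrableOn (F r) (upperHalf n k ∩ sphere 0 r) (μH[(n : ℝ) - 1]))
    (hF : ∀ ε > 0, ∀ᶠ r in atTop, ∀ x ∈ upperHalf n k ∩ sphere 0 r,
      |r ^ ((n : ℝ) - 1) * F r x - c| ≤ ε) :
    Tendsto (fun r : ℝ => ∫ x in upperHalf n k ∩ sphere 0 r, F r x ∂(μH[(n : ℝ) - 1])) atTop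
      (𝓝 (c * (μH[(n : ℝ) - 1]).real (upperHalf n k ∩ sphere 0 1))) := by
  have hfin := hausdorffMeasure_upperHalf_inter_sphere_one_lt_top hn k
  set H := (μH[(n : ℝ) - 1]).real (upperHalf n k ∩ sphere 0 1) with hH
  have hH0 : 0 ≤ H := measureReal_nonneg
  rw [Metric.tendsto_nhds]
  intro ε hε
  filter_upwards [hint, hF (ε / (H + 1)) (by positivity), eventually_gt_atTop 0] with r hi hr hr0
  have hpw : 0 < r ^ ((n : ℝ) - 1) := Real.rpow_pos_of_pos hr0 _
  have hHr := hausdorffMeasure_upperHalf_inter_sphere hn k hr0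
  have hfinr : μH[(n : ℝ) - 1] (upperHalf n k ∩ sphere 0 r) < ⊤ := by
    rw [hHr]
    exact ENNReal.mul_lt_top ENNReal.ofReal_lt_top hfin
  have hHr' : (μH[(n : ℝ) - 1]).real (upperHalf n k ∩ sphere 0 r) = r ^ ((n : ℝ) - 1) * H := by
    rw [measureReal_def, hHr, ENNReal.toReal_mul, ENNReal.toReal_ofReal hpw.le, hH, measureReal_def]
  have hbound := norm_setIntegral_le_of_norm_le_const (μ := μH[(n : ℝ) - 1])
    (f := fun x => r ^ ((n : ℝ) - 1) * F r x - c) hfinr hr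
  rw [integral_sub (hi.const_mul _) (integrableOn_const hfinr.ne), integral_const_mul,
    setIntegral_const, hHr', smul_eq_mul, Real.norm_eq_abs] at hbound
  rw [Real.dist_eq]
  set I := ∫ x in upperHalf n k ∩ sphere 0 r, F r x ∂(μH[(n : ℝ) - 1])
  have h1 : r ^ ((n : ℝ) - 1) * I - r ^ ((n : ℝ) - 1) * H * c =
      r ^ ((n : ℝ) - 1) * (I - c * H) := by ring
  rw [h1, abs_mul, abs_of_pos hpw] at hbound
  have h2 : |I - c * H| ≤ ε / (H + 1) * H := by
    refine le_of_mul_le_mul_left (hbound.trans_eq ?_) hpw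
    ring
  refine h2.trans_lt ?_
  rw [div_mul_eq_mul_div, div_lt_iff₀ (by positivity)]
  nlinarith

/-- Pointwise asymptotics of the mass integrand on large hemispheres. -/
theorem eventually_abs_massIntegrand_sub_le {n : ℕ} (hn : 3 ≤ n) (k : Fin n) {a A : ℝ}
    {u : EuclideanSpace ℝ (Fin n) → ℝ}
    (hu : ContDiffOn ℝ 1 u (extRegionCl n k))
    (hpos : ∀ x ∈ extRegionCl n k, 0 < u x)
    (hexp : ∀ x ∈ extRegionCl n k,
      |u x - 1 - a * ‖x‖ ^ ((2 : ℝ) - n)| ≤ A * ‖x‖ ^ ((1 : ℝ) - n))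
    (hgrad : ∀ x ∈ extRegionCl n k,
      ‖fderivWithin ℝ u (extRegionCl n k) x -
        (((2 : ℝ) - n) * a * ‖x‖ ^ (-(n : ℝ))) • (innerSL ℝ x)‖ ≤ A * ‖x‖ ^ (-(n : ℝ)))
    {ε : ℝ} (hε : 0 < ε) :
    ∀ᶠ r in atTop, ∀ x ∈ upperHalf n k ∩ sphere 0 r,
      |r ^ ((n : ℝ) - 1) * massIntegrand n (extRegionCl n k) u r x - 4 * ((n : ℝ) - 1) * a| ≤ ε := by
  have hn' : (3 : ℝ) ≤ n := by exact_mod_cast hn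
  set p := (4 : ℝ) / ((n : ℝ) - 2) with hp
  set l : Filter (EuclideanSpace ℝ (Fin n)) := comap norm atTop ⊓ 𝓟 (upperHalf n k) with hl
  have hnorm : Tendsto (fun x : EuclideanSpace ℝ (Fin n) => ‖x‖) l atTop :=
    tendsto_comap.mono_left inf_le_left
  have hmem : ∀ᶠ x in l, x ∈ extRegionCl n k := by
    filter_upwards [hnorm.eventually_ge_atTop 1, mem_inf_of_right (mem_principal_self _)]
      with x h1 h2 using ⟨h2, h1⟩
  have hdecay : ∀ b : ℝ, b < 0 →
      Tendsto (fun x : EuclideanSpace ℝ (Fin n) => ‖x‖ ^ b) l (𝓝 0) := fun b hb => by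
    have := (tendsto_rpow_neg_atTop (neg_pos.2 hb)).comp hnorm
    simpa [Function.comp_def] using this
  have hulim : Tendsto u l (𝓝 1) := by
    have h1 : Tendsto (fun x => u x - 1 - a * ‖x‖ ^ ((2 : ℝ) - n)) l (𝓝 0) := by
      refine squeeze_zero_norm' (hmem.mono hexp) ?_
      simpa using (hdecay ((1 : ℝ) - n) (by linarith)).const_mul A
    have h2 := (h1.add ((hdecay ((2 : ℝ) - n) (by linarith)).const_mul a)).add_const 1
    refine (h2.congr fun x => ?_).trans_eq (by simp)
    ring
  have hdlim : Tendsto (fun x => ‖x‖ ^ ((n : ℝ) - 1) *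
      (fderivWithin ℝ u (extRegionCl n k) x x / ‖x‖)) l (𝓝 (((2 : ℝ) - n) * a)) := by
    rw [tendsto_iff_norm_sub_tendsto_zero]
    refine squeeze_zero' (Eventually.of_forall fun _ => norm_nonneg _) (hmem.mono fun x hx => ?_)
      (by simpa using (hdecay (-1) (by norm_num)).const_mul A)
    have hx0 : 0 < ‖x‖ := one_pos.trans_le hx.2
    set L := fderivWithin ℝ u (extRegionCl n k) x
    have h1 := ContinuousLinearMap.le_of_opNorm_le _ (hgrad x hx) x
    have hq : 0 < ‖x‖ ^ (n : ℝ) := Real.rpow_pos_of_pos hx0 _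
    simp only [sub_apply, smul_apply, innerSL_apply_apply,
      real_inner_self_eq_norm_sq, smul_eq_mul, Real.rpow_neg hx0.le] at h1
    rw [Real.rpow_sub hx0, Real.rpow_one, Real.rpow_neg_one, Real.norm_eq_abs]
    have h2 : ‖x‖ ^ (n : ℝ) / ‖x‖ * (L x / ‖x‖) - (2 - n) * a =
        ‖x‖ ^ (n : ℝ) / ‖x‖ ^ 2 * (L x - (2 - n) * a * (‖x‖ ^ (n : ℝ))⁻¹ * ‖x‖ ^ 2) := by
      field_simp
    rw [h2, abs_mul, abs_of_pos (by positivity)]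
    refine (mul_le_mul_of_nonneg_left h1 (by positivity)).trans_eq ?_
    field_simp
  have hlim : Tendsto (fun x => ‖x‖ ^ ((n : ℝ) - 1) *
      massIntegrand n (extRegionCl n k) u ‖x‖ x) l (𝓝 (4 * ((n : ℝ) - 1) * a)) := by
    have hup : Tendsto (fun x => u x ^ (p - 1)) l (𝓝 1) := by
      simpa using hulim.rpow_const (p := p - 1) (Or.inl one_ne_zero)
    have h := (hup.const_mul ((1 - (n : ℝ)) * p)).mul hdlim
    have hval : (1 - (n : ℝ)) * p * 1 * ((2 - n) * a) = 4 * ((n : ℝ) - 1) * a := by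
      have : (n : ℝ) - 2 ≠ 0 := by linarith
      rw [hp]
      field_simp
      ring
    rw [hval] at h
    refine h.congr' (hmem.mono fun x hx => ?_)
    dsimp only
    rw [massIntegrand_eq (uniqueDiffOn_extRegionCl n k x hx)
      (hu.differentiableOn one_ne_zero x hx) (hpos x hx)]
    ring
  have hev := (Metric.tendsto_nhds.1 hlim) ε hε
  rw [hl, eventually_inf_principal, eventually_comap] at hev
  filter_upwards [hev] with r hr x hx
  have hxr : ‖x‖ = r := mem_sphere_zero_iff_norm.1 hx.2
  have := hr x hxr hx.1
  rw [hxr, Real.dist_eq] at this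
  exact this.le

/-- for a positive `C¹` function `u` on `E = {x ∈ ℝⁿ₊ : |x| ≥ 1}` with
`u = 1 + a|x|^{2-n} + O(|x|^{1-n})` and `∇u = (2-n)a|x|^{-n}x + O(|x|^{-n})`, the mass of the
conformally flat metric `g = u^{4/(n-2)}δ` exists and equals `2(n-1)ω_{n-1}a`. -/
theorem stmt_11 (n : ℕ) (hn : 3 ≤ n) (a A : ℝ) (hA : 0 < A)
    (u : EuclideanSpace ℝ (Fin n) → ℝ)
    (hu : ContDiffOn ℝ 1 u (extRegionCl n ⟨n - 1, by omega⟩))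
    (hpos : ∀ x ∈ extRegionCl n ⟨n - 1, by omega⟩, 0 < u x)
    (hexp : ∀ x ∈ extRegionCl n ⟨n - 1, by omega⟩,
      |u x - 1 - a * ‖x‖ ^ ((2 : ℝ) - n)| ≤ A * ‖x‖ ^ ((1 : ℝ) - n))
    (hgrad : ∀ x ∈ extRegionCl n ⟨n - 1, by omega⟩,
      ‖fderivWithin ℝ u (extRegionCl n ⟨n - 1, by omega⟩) x -
        (((2 : ℝ) - n) * a * ‖x‖ ^ (-(n : ℝ))) • (innerSL ℝ x)‖ ≤
        A * ‖x‖ ^ (-(n : ℝ))) :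
    (∀ r : ℝ, 1 ≤ r →
      IntegrableOn (massIntegrand n (extRegionCl n ⟨n - 1, by omega⟩) u r)
        (upperHalf n ⟨n - 1, by omega⟩ ∩ sphere 0 r) (μH[(n : ℝ) - 1])) ∧
    Tendsto
      (fun r : ℝ => ∫ x in upperHalf n ⟨n - 1, by omega⟩ ∩ sphere 0 r,
        massIntegrand n (extRegionCl n ⟨n - 1, by omega⟩) u r x ∂(μH[(n : ℝ) - 1]))
      atTop (𝓝 (2 * ((n : ℝ) - 1) * sphereArea n * a)) := by
  have hn1 : 1 ≤ n := by omega
  have hS := uniqueDiffOn_extRegionCl n ⟨n - 1, by omega⟩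
  have hint : ∀ r : ℝ, 1 ≤ r →
      IntegrableOn (massIntegrand n (extRegionCl n ⟨n - 1, by omega⟩) u r)
        (upperHalf n ⟨n - 1, by omega⟩ ∩ sphere 0 r) (μH[(n : ℝ) - 1]) := by
    intro r hr
    have hr0 : 0 < r := one_pos.trans_le hr
    have hcomp : IsCompact (upperHalf n ⟨n - 1, by omega⟩ ∩ sphere 0 r) :=
      (isCompact_sphere 0 r).inter_left (isClosed_le continuous_const (by fun_prop))
    have hcont := (continuousOn_massIntegrand hS hu hpos r).mono
      (s := extRegionCl n ⟨n - 1, by omega⟩) (t := upperHalf n ⟨n - 1, by omega⟩ ∩ sphere 0 r)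
      fun x hx => ⟨hx.1, hr.trans_eq (mem_sphere_zero_iff_norm.1 hx.2).symm⟩
    obtain ⟨C, hC⟩ := hcomp.exists_bound_of_continuousOn hcont
    refine IntegrableOn.of_bound ?_
      (hcont.aestronglyMeasurable_of_isCompact hcomp hcomp.measurableSet) C
      (ae_restrict_of_forall_mem hcomp.measurableSet hC)
    rw [hausdorffMeasure_upperHalf_inter_sphere hn1 _ hr0]
    exact ENNReal.mul_lt_top ENNReal.ofReal_lt_top
      (hausdorffMeasure_upperHalf_inter_sphere_one_lt_top hn1 _)
  refine ⟨hint, ?_⟩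
  have hlim := tendsto_setIntegral_upperHalf_inter_sphere hn1 _
    ((eventually_ge_atTop 1).mono hint)
    fun ε hε => eventually_abs_massIntegrand_sub_le hn _ hu hpos hexp hgrad hε
  convert hlim using 2
  rw [sphereArea_eq hn1 ⟨n - 1, by omega⟩]
  ring
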